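/- Let F₁, …, F_K be jointly irreducible probability distributions, let η₁, η₂ ∈ Δ_K with η₁ ≠ η₂, and let Q_i = ∑_{k=1}^K η_{i,k} F_k for i = 1, 2. Let R be the residue of Q₁ with respect to Q₂. Then the following are equivalent: (a) S(η₂) ⊄ S(η₁); (b) R = Q₁; (c) κ*(Q₁ | Q₂) = 0. -/

import Mathlib

open MeasureTheory

/-- Probability distributions `P₁, …, P_L` are *jointly irreducible* if whenever a real linear
combination `∑ γᵢ Pᵢ` (in the space of finite signed measures) is a probability distribution,
all coefficients `γᵢ` are nonnegative. -/
def JointlyIrreducible {X : Type*} [MeasurableSpace X] {L : ℕ}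
    (P : Fin L → Measure X) [∀ j, IsProbabilityMeasure (P j)] : Prop :=
  ∀ (γ : Fin L → ℝ) (Q : Measure X) (_ : IsProbabilityMeasure Q),
    Q.toSignedMeasure = ∑ i, γ i • (P i).toSignedMeasure → ∀ i, 0 ≤ γ i

/-- The two-sample operator
`κ*(F₀ | F₁) = sup {κ ∈ [0,1] : ∃ probability G, F₀ = (1−κ)G + κF₁}`. -/
noncomputable def kappaTwo {X : Type*} [MeasurableSpace X]
    (F₀ F₁ : Measure X) [IsFiniteMeasure F₀] [IsFiniteMeasure F₁] : ℝ :=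
  sSup {κ : ℝ | κ ∈ Set.Icc (0 : ℝ) 1 ∧ ∃ (G : Measure X) (_ : IsProbabilityMeasure G),
    F₀.toSignedMeasure = (1 - κ) • G.toSignedMeasure + κ • F₁.toSignedMeasure}

/-- A convex combination of probability measures is realised by a probability measure. -/
lemma exists_isProbabilityMeasure_toSignedMeasure_eq_sum {X : Type*} [MeasurableSpace X] {K : ℕ}
    (F : Fin K → Measure X) [∀ k, IsProbabilityMeasure (F k)]
    {w : Fin K → ℝ} (hw : w ∈ stdSimplex ℝ (Fin K)) :
    ∃ (G : Measure X) (_ : IsProbabilityMeasure G),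
      G.toSignedMeasure = ∑ k, w k • (F k).toSignedMeasure := by
  have hprob : IsProbabilityMeasure (∑ k, ENNReal.ofReal (w k) • F k) := by
    constructor
    simp [Measure.finsetSum_apply, ← ENNReal.ofReal_sum_of_nonneg (fun k _ => hw.1 k), hw.2]
  refine ⟨_, hprob, ?_⟩
  ext s hs
  rw [Measure.toSignedMeasure_apply_measurable hs, measureReal_def, Measure.finsetSum_apply,
    ENNReal.toReal_sum fun k _ => by
      simpa using ENNReal.mul_ne_top ENNReal.ofReal_ne_top (measure_ne_top (F k) s)]
  simp [Measure.toSignedMeasure_apply_measurable hs,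
    measureReal_def, hw.1 _]

/-- Jointly irreducible distributions are linearly independent. -/
lemma JointlyIrreducible.linearIndependent {X : Type*} [MeasurableSpace X] {K : ℕ}
    {F : Fin K → Measure X} [∀ k, IsProbabilityMeasure (F k)] (hF : JointlyIrreducible F) :
    LinearIndependent ℝ fun k => (F k).toSignedMeasure := by
  rw [Fintype.linearIndependent_iff]
  intro γ hγ i
  have key : ∀ t : ℝ, 0 ≤ 1 + t * γ i := by
    intro t
    have h := hF (fun k => (Pi.single i (1 : ℝ) : Fin K → ℝ) k + t * γ k) (F i) inferInstance (by
      simp [add_smul, Finset.sum_add_distrib, mul_smul, ← Finset.smul_sum, hγ,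
        Pi.single_apply, ite_smul]) i
    simpa using h
  by_contra hne
  have h := key (-2 / γ i)
  rw [div_mul_cancel₀ _ hne] at h
  norm_num at h

/-- A positive multiple of `v` lies below `u` when the support of `v` is contained in
the support of `u`. -/
lemma exists_mul_le_of_support_subset {K : ℕ} {u v : Fin K → ℝ} (hu : ∀ k, 0 ≤ u k)
    (hv : ∀ k, 0 ≤ v k) (hsub : {j | 0 < v j} ⊆ {j | 0 < u j}) :
    ∃ κ : ℝ, 0 < κ ∧ κ < 1 ∧ ∀ k, κ * v k ≤ u k := by
  have h : ∀ᶠ κ : ℝ in nhdsWithin 0 (Set.Ioi 0), ∀ k, κ * v k ≤ u k := by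
    rw [Filter.eventually_all]
    intro k
    rcases (hv k).eq_or_lt with h0 | hpos
    · simp [← h0, hu k]
    · have hlim : Filter.Tendsto (fun κ : ℝ => κ * v k) (nhdsWithin 0 (Set.Ioi 0)) (nhds 0) := by
        have hc : Continuous fun κ : ℝ => κ * v k := by fun_prop
        simpa using (hc.tendsto 0).mono_left nhdsWithin_le_nhds
      exact hlim.eventually_le_const (hsub hpos)
  obtain ⟨κ, hκ, hIoo⟩ := (h.and (Ioo_mem_nhdsGT (zero_lt_one (α := ℝ)))).exists
  exact ⟨κ, hIoo.1, hIoo.2, hκ⟩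

/-- With `R` the residue of `Q₁` with respect to `Q₂`, the following are
equivalent: (a) `S(η₂) ⊄ S(η₁)`; (b) `R = Q₁`; (c) `κ*(Q₁ | Q₂) = 0`, where
`S(η) = {j : η j > 0}` is the support set. -/
theorem stmt8 {X : Type*} [MeasurableSpace X] {K : ℕ}
    (F : Fin K → Measure X) [∀ k, IsProbabilityMeasure (F k)]
    (hJI : JointlyIrreducible F)
    (η₁ η₂ : Fin K → ℝ) (hη₁ : η₁ ∈ stdSimplex ℝ (Fin K)) (hη₂ : η₂ ∈ stdSimplex ℝ (Fin K))
    (hne : η₁ ≠ η₂)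
    (Q₁ Q₂ : Measure X) [IsProbabilityMeasure Q₁] [IsProbabilityMeasure Q₂]
    (hQ₁ : Q₁.toSignedMeasure = ∑ k, η₁ k • (F k).toSignedMeasure)
    (hQ₂ : Q₂.toSignedMeasure = ∑ k, η₂ k • (F k).toSignedMeasure)
    (R : Measure X) [IsProbabilityMeasure R]
    (hR : Q₁.toSignedMeasure = (1 - kappaTwo Q₁ Q₂) • R.toSignedMeasure
      + kappaTwo Q₁ Q₂ • Q₂.toSignedMeasure) :
    (¬ {j | 0 < η₂ j} ⊆ {j | 0 < η₁ j} ↔ R = Q₁) ∧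
    (R = Q₁ ↔ kappaTwo Q₁ Q₂ = 0) := by
  have hinj : Q₁.toSignedMeasure ≠ Q₂.toSignedMeasure := fun h => by
    refine hne (funext fun k => ?_)
    refine sub_eq_zero.1 (Fintype.linearIndependent_iff.1 hJI.linearIndependent (η₁ - η₂) ?_ k)
    simp only [Pi.sub_apply, sub_smul, Finset.sum_sub_distrib, ← hQ₁, ← hQ₂, h, sub_self]
  have hbc : R = Q₁ ↔ kappaTwo Q₁ Q₂ = 0 := by
    constructor
    · rintro rfl
      have h : kappaTwo R Q₂ • (R.toSignedMeasure - Q₂.toSignedMeasure) = 0 := by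
        have hs := sub_smul (1 : ℝ) (kappaTwo R Q₂) R.toSignedMeasure
        rw [one_smul] at hs
        rw [hs] at hR
        rw [smul_sub, sub_eq_zero]
        rwa [sub_add, eq_comm, sub_eq_self, sub_eq_zero] at hR
      exact (smul_eq_zero.1 h).resolve_right (sub_ne_zero.2 hinj)
    · intro h
      rw [h] at hR
      exact (Measure.toSignedMeasure_eq_toSignedMeasure_iff.1 (by simpa using hR)).symm
  refine ⟨Iff.trans ?_ hbc.symm, hbc⟩
  constructor
  · intro hsub
    obtain ⟨k, hk₂, hk₁⟩ := Set.not_subset.1 hsub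
    have hk₀ : η₁ k = 0 := le_antisymm (not_lt.1 hk₁) (hη₁.1 k)
    refine le_antisymm (Real.sSup_nonpos ?_) (Real.sSup_nonneg fun κ hκ => hκ.1.1)
    rintro κ ⟨⟨-, hκ1⟩, G, hG, hQ⟩
    rcases hκ1.eq_or_lt with rfl | hlt
    · exact absurd (by simpa using hQ) hinj
    have hpos : 0 < 1 - κ := sub_pos.2 hlt
    have h := hJI (fun j => (1 - κ)⁻¹ * (η₁ j - κ * η₂ j)) G hG (by
      simp only [mul_smul, sub_smul, ← Finset.smul_sum, Finset.sum_sub_distrib, ← hQ₁, ← hQ₂]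
      rw [hQ, add_sub_cancel_right, inv_smul_smul₀ hpos.ne']) k
    have h' := nonneg_of_mul_nonneg_right h (inv_pos.2 hpos)
    rw [hk₀, zero_sub, neg_nonneg] at h'
    exact nonpos_of_mul_nonpos_left h' hk₂
  · intro h0 hsub
    obtain ⟨κ, hκ0, hκ1, hle⟩ := exists_mul_le_of_support_subset hη₁.1 hη₂.1 hsub
    have hpos : 0 < 1 - κ := sub_pos.2 hκ1
    have hw : (fun j => (1 - κ)⁻¹ * (η₁ j - κ * η₂ j)) ∈ stdSimplex ℝ (Fin K) := by
      refine ⟨fun j => mul_nonneg (inv_nonneg.2 hpos.le) (sub_nonneg.2 (hle j)), ?_⟩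
      rw [← Finset.mul_sum, Finset.sum_sub_distrib, ← Finset.mul_sum, hη₁.2, hη₂.2, mul_one,
        inv_mul_cancel₀ hpos.ne']
    obtain ⟨G, hG, hGsum⟩ := exists_isProbabilityMeasure_toSignedMeasure_eq_sum F hw
    have hmem : κ ≤ kappaTwo Q₁ Q₂ := by
      refine le_csSup ⟨1, fun x hx => hx.1.2⟩ ⟨⟨hκ0.le, hκ1.le⟩, G, hG, ?_⟩
      simp only [mul_smul, sub_smul, ← Finset.smul_sum, Finset.sum_sub_distrib, ← hQ₁, ← hQ₂]
        at hGsum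
      rw [hGsum, smul_inv_smul₀ hpos.ne', sub_add_cancel]
    exact absurd h0 (hκ0.trans_le hmem).ne'
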